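/- Possibility with deterministic rewards: let 𝒰 be any nonempty family of strictly increasing functions U : [0,1] → ℝ with U(0) = 0. Then the proportional allocation rule is the unique allocation rule (interpreted as giving deterministic fractional rewards) that is symmetric, strongly budget-balanced, sybil-proof, and weakly collusion-proof against 𝒰 under proportional sharing, where the last condition means: for every configuration h of length n, every choice of utility functions U_i ∈ 𝒰 for the miners, every nonempty subset T ⊆ {1,…,n}, and every configuration h' obtained from h by replacing the entries indexed by T with a single new entry i* whose hash rate is at most ∑_{j∈T} h_j (all other entries unchanged), there exists i ∈ T with U_i(x_{i*}(h')·h_i/(∑_{j∈T} h_j)) ≤ U_i(x_i(h)). -/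

import Mathlib

/-- An *allocation rule* maps every configuration (a finite tuple of positive
integer hash rates) of every length to a tuple of nonnegative real
(expected) rewards of the same length. -/
structure AllocRule where
  alloc : ∀ {n : ℕ}, (Fin n → ℕ+) → Fin n → ℝ
  nonneg : ∀ {n : ℕ} (h : Fin n → ℕ+) (i : Fin n), 0 ≤ alloc h i

/-- A1: symmetry: `x (π h) = π (x h)` for every permutation `π`. -/
def SymmetricRule (x : AllocRule) : Prop :=
  ∀ {n : ℕ}, 0 < n → ∀ (h : Fin n → ℕ+) (π : Equiv.Perm (Fin n)) (i : Fin n),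
    x.alloc (h ∘ π) i = x.alloc h (π i)

/-- A2a: strong budget balance. -/
def StronglyBudgetBalanced (x : AllocRule) : Prop :=
  ∀ {n : ℕ}, 0 < n → ∀ h : Fin n → ℕ+, ∑ i, x.alloc h i = 1

/-- A2b: weak budget balance. -/
def WeaklyBudgetBalanced (x : AllocRule) : Prop :=
  ∀ {n : ℕ}, 0 < n → ∀ h : Fin n → ℕ+, ∑ i, x.alloc h i ≤ 1

/-- `h'` (whose set of new-entry positions is `S`) is obtained from `h` by
replacing the single entry at index `i` with a finite tuple of positive
integers summing to at most `h i`, all other entries unchanged. -/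
def IsSybilSplit {n m : ℕ} (h : Fin n → ℕ+) (i : Fin n)
    (h' : Fin m → ℕ+) (S : Finset (Fin m)) : Prop :=
  S.Nonempty ∧
  ∃ e : {j : Fin n // j ≠ i} ↪ Fin m,
    (∀ j, h' (e j) = h j.1) ∧
    (∀ k : Fin m, k ∈ S ↔ k ∉ Set.range e) ∧
    (∑ k ∈ S, (h' k : ℕ)) ≤ (h i : ℕ)

/-- A3: sybil-proofness. -/
def SybilProof (x : AllocRule) : Prop :=
  ∀ {n m : ℕ}, 0 < n →
    ∀ (h : Fin n → ℕ+) (i : Fin n) (h' : Fin m → ℕ+) (S : Finset (Fin m)),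
      IsSybilSplit h i h' S → ∑ j ∈ S, x.alloc h' j ≤ x.alloc h i

/-- `h'` (with merged-miner position `istar`) is obtained from `h` by
replacing the (nonempty) set `T` of miners with a single new miner whose hash
rate is at most the total hash rate of `T`, all other entries unchanged. -/
def IsMerge {n m : ℕ} (h : Fin n → ℕ+) (T : Finset (Fin n))
    (h' : Fin m → ℕ+) (istar : Fin m) : Prop :=
  T.Nonempty ∧
  ∃ e : {j : Fin n // j ∉ T} ↪ Fin m,
    (∀ j, h' (e j) = h j.1) ∧
    (∀ k : Fin m, k = istar ↔ k ∉ Set.range e) ∧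
    (h' istar : ℕ) ≤ ∑ j ∈ T, (h j : ℕ)

/-- A4a: collusion-proofness under arbitrary reward sharing. -/
def CollusionProofArbitrary (x : AllocRule) : Prop :=
  ∀ {n m : ℕ}, 0 < n →
    ∀ (h : Fin n → ℕ+) (T : Finset (Fin n)) (h' : Fin m → ℕ+) (istar : Fin m),
      IsMerge h T h' istar → x.alloc h' istar ≤ ∑ j ∈ T, x.alloc h j

/-- A4b: strong collusion-proofness under proportional sharing. -/
def StronglyCollusionProof (x : AllocRule) : Prop :=
  ∀ {n m : ℕ}, 0 < n →
    ∀ (h : Fin n → ℕ+) (T : Finset (Fin n)) (h' : Fin m → ℕ+) (istar : Fin m),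
      IsMerge h T h' istar →
      (∃ i ∈ T, x.alloc h i <
        x.alloc h' istar * (((h i : ℕ) : ℝ) / ∑ j ∈ T, ((h j : ℕ) : ℝ))) →
      ∃ l ∈ T, x.alloc h' istar * (((h l : ℕ) : ℝ) / ∑ j ∈ T, ((h j : ℕ) : ℝ))
        < x.alloc h l

/-- A4c: weak collusion-proofness under proportional sharing. -/
def WeaklyCollusionProof (x : AllocRule) : Prop :=
  ∀ {n m : ℕ}, 0 < n →
    ∀ (h : Fin n → ℕ+) (T : Finset (Fin n)) (h' : Fin m → ℕ+) (istar : Fin m),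
      IsMerge h T h' istar →
      ∃ i ∈ T, x.alloc h' istar * (((h i : ℕ) : ℝ) / ∑ j ∈ T, ((h j : ℕ) : ℝ))
        ≤ x.alloc h i

/-- Bitcoin's proportional allocation rule. -/
noncomputable def propRule : AllocRule where
  alloc := fun {n} h i => ((h i : ℕ) : ℝ) / ∑ j, ((h j : ℕ) : ℝ)
  nonneg := fun h i => div_nonneg (Nat.cast_nonneg _)
    (Finset.sum_nonneg fun j _ => Nat.cast_nonneg _)

/-- Weak collusion-proofness against a family `𝒰` of utility functions, for
deterministic fractional rewards: for every choice of utilities `Us i ∈ 𝒰` for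
the miners and every merge of a coalition `T` into a single miner `istar`,
some member of `T` does not strictly gain under proportional sharing. -/
def WeaklyCollusionProofAgainstFamilyDet (𝒰 : Set (ℝ → ℝ)) (x : AllocRule) : Prop :=
  ∀ {n m : ℕ}, 0 < n → ∀ (Us : Fin n → ℝ → ℝ), (∀ i, Us i ∈ 𝒰) →
    ∀ (h : Fin n → ℕ+) (T : Finset (Fin n)) (h' : Fin m → ℕ+) (istar : Fin m),
      IsMerge h T h' istar →
      ∃ i ∈ T,
        Us i (x.alloc h' istar * (((h i : ℕ) : ℝ) / ∑ j ∈ T, ((h j : ℕ) : ℝ)))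
          ≤ Us i (x.alloc h i)

/-- A sum over `Fin m` splits into the part outside the range of an embedding and the part
inside it. -/
lemma sum_eq_sum_add_sum_embedding {m : ℕ} {α : Type*} [Fintype α] (e : α ↪ Fin m)
    (S : Finset (Fin m)) (hS : ∀ k, k ∈ S ↔ k ∉ Set.range e) (f : Fin m → ℝ) :
    ∑ k, f k = ∑ k ∈ S, f k + ∑ a, f (e a) := by
  classical
  have hSc : Sᶜ = Finset.univ.map e := by
    ext k
    simp [hS]
  rw [← Finset.sum_add_sum_compl S f, hSc, Finset.sum_map]

/-- Replacing miner `i` by `h i` miners of unit hash rate is a sybil split of `h`, and `h` is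
recovered by merging these unit miners back. -/
lemma exists_unit_split {n : ℕ} (h : Fin n → ℕ+) (i : Fin n) :
    ∃ (m : ℕ) (h' : Fin m → ℕ+) (S : Finset (Fin m)), 0 < m ∧
      IsSybilSplit h i h' S ∧ IsMerge h' S h i ∧ (∀ k ∈ S, h' k = 1) ∧
      S.card = (h i : ℕ) ∧ ∑ k, ((h' k : ℕ) : ℝ) = ∑ k, ((h k : ℕ) : ℝ) ∧
      (h i ≠ 1 → (Finset.univ.filter fun k => h' k ≠ 1).card
        < (Finset.univ.filter fun k => h k ≠ 1).card) := by
  classical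
  let α := {j : Fin n // j ≠ i} ⊕ Fin (h i : ℕ)
  let q : α ≃ Fin (Fintype.card α) := Fintype.equivFin α
  let h' : Fin (Fintype.card α) → ℕ+ := fun k => Sum.elim (fun j => h j.1) (fun _ => 1) (q.symm k)
  let e : {j : Fin n // j ≠ i} ↪ Fin (Fintype.card α) := Function.Embedding.inl.trans q.toEmbedding
  let S : Finset (Fin (Fintype.card α)) :=
    Finset.univ.map ((Function.Embedding.inr : Fin (h i : ℕ) ↪ α).trans q.toEmbedding)
  have he : ∀ j, h' (e j) = h j.1 := fun j => by simp [h', e]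
  have hSe : ∀ k, k ∈ S ↔ k ∉ Set.range e := by
    intro k
    obtain ⟨a, rfl⟩ := q.surjective k
    rcases a with a | a <;> simp [S, e]
  have hS1 : ∀ k ∈ S, h' k = 1 := by
    intro k hk
    obtain ⟨a, -, rfl⟩ := Finset.mem_map.1 hk
    simp [h']
  have hcard : S.card = (h i : ℕ) := by simp [S]
  have hsumS : ∑ k ∈ S, (h' k : ℕ) = (h i : ℕ) := by
    rw [Finset.sum_congr rfl fun k hk => by rw [hS1 k hk]]
    simp [hcard]
  have hSne : S.Nonempty := Finset.card_pos.1 (by rw [hcard]; exact (h i).pos)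
  have hpre : ∀ k : {k // k ∉ S}, ∃ j, e j = k.1 := fun k => by
    have := k.2
    rw [hSe, not_not] at this
    exact this
  choose r hr using hpre
  refine ⟨_, h', S, hSne.choose.pos, ⟨hSne, e, he, hSe, hsumS.le⟩,
    ⟨hSne, ⟨fun k => (r k).1, fun k l hkl => ?_⟩, fun k => ?_, fun k => ?_, hsumS.ge⟩,
    hS1, hcard, ?_, fun hi => ?_⟩
  · apply Subtype.ext
    rw [← hr k, ← hr l, Subtype.ext hkl]
  · change h (r k).1 = h' k.1
    rw [← hr k, he]
  · constructor
    · rintro rfl ⟨l, hl⟩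
      exact (r l).2 hl
    · intro hk
      by_contra hki
      have hmem : e ⟨k, hki⟩ ∉ S := by
        rw [hSe, not_not]
        exact ⟨_, rfl⟩
      refine hk ⟨⟨_, hmem⟩, ?_⟩
      exact congrArg Subtype.val (e.injective (hr ⟨_, hmem⟩))
  · have hsumS' : ∑ k ∈ S, ((h' k : ℕ) : ℝ) = ((h i : ℕ) : ℝ) := by exact_mod_cast hsumS
    rw [sum_eq_sum_add_sum_embedding e S hSe fun k => ((h' k : ℕ) : ℝ), hsumS',
      sum_eq_sum_add_sum_embedding (Function.Embedding.subtype fun j => j ≠ i) {i} (by simp)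
        fun k => ((h k : ℕ) : ℝ)]
    simp [he]
  · have hsub : (Finset.univ.filter fun k => h' k ≠ 1) ⊆
        ((Finset.univ.filter fun k => h k ≠ 1).erase i).attach.map
          ⟨fun j => e ⟨j.1, Finset.ne_of_mem_erase j.2⟩, fun j l hjl => by
            have := congrArg Subtype.val (e.injective hjl)
            exact Subtype.ext this⟩ := by
      intro k hk
      have hk1 : h' k ≠ 1 := (Finset.mem_filter.1 hk).2
      have hkS : k ∉ S := fun hkS => hk1 (hS1 k hkS)
      rw [hSe, not_not] at hkS
      obtain ⟨j, rfl⟩ := hkS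
      rw [he] at hk1
      exact Finset.mem_map.2 ⟨⟨j.1, by simp [j.2, hk1]⟩, Finset.mem_attach _ _, rfl⟩
    refine (Finset.card_le_card hsub).trans_lt ?_
    rw [Finset.card_map, Finset.card_attach]
    exact Finset.card_erase_lt_of_mem (by simp [hi])

lemma sum_hash_pos {n : ℕ} (hn : 0 < n) (h : Fin n → ℕ+) : 0 < ∑ j, ((h j : ℕ) : ℝ) :=
  Finset.sum_pos (fun j _ => Nat.cast_pos.2 (h j).pos) ⟨⟨0, hn⟩, Finset.mem_univ _⟩

/-- A strongly budget-balanced allocation lies in the unit interval. -/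
lemma StronglyBudgetBalanced.alloc_mem_Icc {x : AllocRule} (hx : StronglyBudgetBalanced x)
    {n : ℕ} (h : Fin n → ℕ+) (i : Fin n) : x.alloc h i ∈ Set.Icc (0 : ℝ) 1 :=
  ⟨x.nonneg h i, (hx i.pos h) ▸
    Finset.single_le_sum (fun j _ => x.nonneg h j) (Finset.mem_univ i)⟩

lemma share_mem_Icc {n : ℕ} (h : Fin n → ℕ+) {T : Finset (Fin n)} {i : Fin n} (hi : i ∈ T) :
    ((h i : ℕ) : ℝ) / ∑ j ∈ T, ((h j : ℕ) : ℝ) ∈ Set.Icc (0 : ℝ) 1 := by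
  refine ⟨by positivity, div_le_one_of_le₀ ?_ (by positivity)⟩
  exact Finset.single_le_sum (f := fun j => ((h j : ℕ) : ℝ)) (fun j _ => by positivity) hi

/-- Against strictly increasing utilities, deterministic weak collusion-proofness is the
utility-free one. -/
lemma weaklyCollusionProofAgainstFamilyDet_iff {𝒰 : Set (ℝ → ℝ)} (hne : 𝒰.Nonempty)
    (hmono : ∀ U ∈ 𝒰, StrictMonoOn U (Set.Icc (0 : ℝ) 1)) {x : AllocRule}
    (hx : StronglyBudgetBalanced x) :
    WeaklyCollusionProofAgainstFamilyDet 𝒰 x ↔ WeaklyCollusionProof x := by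
  have key : ∀ {n m : ℕ} (h : Fin n → ℕ+) (T : Finset (Fin n)) (h' : Fin m → ℕ+) (istar : Fin m),
      ∀ U ∈ 𝒰, ∀ i ∈ T,
        (U (x.alloc h' istar * (((h i : ℕ) : ℝ) / ∑ j ∈ T, ((h j : ℕ) : ℝ))) ≤ U (x.alloc h i) ↔
          x.alloc h' istar * (((h i : ℕ) : ℝ) / ∑ j ∈ T, ((h j : ℕ) : ℝ)) ≤ x.alloc h i) := by
    intro n m h T h' istar U hU i hi
    have ha := hx.alloc_mem_Icc h' istar
    have hs := share_mem_Icc h hi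
    exact (hmono U hU).le_iff_le
      ⟨mul_nonneg ha.1 hs.1, mul_le_one₀ ha.2 hs.1 hs.2⟩ (hx.alloc_mem_Icc h i)
  constructor
  · intro H n m hn h T h' istar hM
    obtain ⟨U, hU⟩ := hne
    obtain ⟨i, hi, hle⟩ := H hn (fun _ => U) (fun _ => hU) h T h' istar hM
    exact ⟨i, hi, (key h T h' istar U hU i hi).1 hle⟩
  · intro H n m hn Us hUs h T h' istar hM
    obtain ⟨i, hi, hle⟩ := H hn h T h' istar hM
    exact ⟨i, hi, (key h T h' istar _ (hUs i) i hi).2 hle⟩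

/-- Symmetry gives equal rewards to miners with equal hash rates. -/
lemma SymmetricRule.alloc_eq_of_eq {x : AllocRule} (hx : SymmetricRule x) {n : ℕ}
    (h : Fin n → ℕ+) {i j : Fin n} (hij : h i = h j) : x.alloc h i = x.alloc h j := by
  have hswap : h ∘ Equiv.swap i j = h := by
    funext k
    simp only [Function.comp_apply, Equiv.swap_apply_def]
    split_ifs with h1 h2
    · rw [h1, hij]
    · rw [h2, hij]
    · rfl
  have := hx i.pos h (Equiv.swap i j) i
  rwa [hswap, Equiv.swap_apply_left] at this

/-- Symmetry, strong budget balance, sybil-proofness and weak collusion-proofness force the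
proportional rewards. -/
theorem alloc_eq_proportional {x : AllocRule} (hsym : SymmetricRule x)
    (hbal : StronglyBudgetBalanced x) (hsyb : SybilProof x) (hcol : WeaklyCollusionProof x)
    {n : ℕ} (h : Fin n → ℕ+) (i : Fin n) :
    x.alloc h i = ((h i : ℕ) : ℝ) / ∑ j, ((h j : ℕ) : ℝ) := by
  induction hc : (Finset.univ.filter fun k => h k ≠ 1).card using Nat.strong_induction_on
    generalizing n with
  | _ c ih =>
  subst hc
  have hne1 : ∀ j, h j ≠ 1 → x.alloc h j = ((h j : ℕ) : ℝ) / ∑ k, ((h k : ℕ) : ℝ) := by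
    intro j hj
    obtain ⟨m, h', S, hm, hsplit, hmerge, hS1, hcard, hsum, hlt⟩ := exists_unit_split h j
    have hunit : ∀ k ∈ S, x.alloc h' k = 1 / ∑ k, ((h k : ℕ) : ℝ) := by
      intro k hk
      rw [ih _ (hlt hj) h' k rfl, hS1 k hk, hsum]
      simp
    apply le_antisymm
    · obtain ⟨k, hk, hle⟩ := hcol hm h' S h j hmerge
      have hsumS : ∑ l ∈ S, ((h' l : ℕ) : ℝ) = ((h j : ℕ) : ℝ) := by
        rw [Finset.sum_congr rfl fun l hl => by rw [hS1 l hl]]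
        simp [hcard]
      have hpos : (0 : ℝ) < ((h j : ℕ) : ℝ) := Nat.cast_pos.2 (h j).pos
      rw [hunit k hk, hsumS, hS1 k hk, PNat.one_coe, Nat.cast_one, mul_one_div,
        div_le_iff₀ hpos] at hle
      rwa [one_div, inv_mul_eq_div] at hle
    · have := hsyb j.pos h j h' S hsplit
      rw [Finset.sum_congr rfl hunit, Finset.sum_const, hcard, nsmul_eq_mul, mul_one_div] at this
      exact this
  by_cases hi : h i = 1
  · have hH := sum_hash_pos i.pos h
    have hzero : ∑ j, (x.alloc h j - ((h j : ℕ) : ℝ) / ∑ k, ((h k : ℕ) : ℝ)) = 0 := by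
      rw [Finset.sum_sub_distrib, hbal i.pos h, ← Finset.sum_div, div_self hH.ne', sub_self]
    have hterm : ∀ j, h j = 1 → x.alloc h j - ((h j : ℕ) : ℝ) / ∑ k, ((h k : ℕ) : ℝ)
        = x.alloc h i - ((h i : ℕ) : ℝ) / ∑ k, ((h k : ℕ) : ℝ) := fun j hj => by
      have hji : h j = h i := hj.trans hi.symm
      rw [hsym.alloc_eq_of_eq h hji, hji]
    rw [← Finset.sum_filter_add_sum_filter_not Finset.univ (fun j => h j = 1),
      Finset.sum_congr rfl fun j hj => hterm j (Finset.mem_filter.1 hj).2,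
      Finset.sum_eq_zero (s := Finset.univ.filter fun j => ¬ h j = 1)
        fun j hj => sub_eq_zero.2 (hne1 j (Finset.mem_filter.1 hj).2),
      add_zero, Finset.sum_const, smul_eq_zero] at hzero
    rcases hzero with h0 | h0
    · exact absurd h0 (Finset.card_ne_zero_of_mem (a := i) (by simp [hi]))
    · exact sub_eq_zero.1 h0
  · exact hne1 i hi

/-- Rewards of the proportional rule on nonempty configurations. -/
def IsProportional (x : AllocRule) : Prop :=
  ∀ (n : ℕ), 0 < n → ∀ (h : Fin n → ℕ+) (i : Fin n),
    x.alloc h i = ((h i : ℕ) : ℝ) / ∑ j, ((h j : ℕ) : ℝ)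

lemma IsProportional.symmetricRule {x : AllocRule} (hx : IsProportional x) : SymmetricRule x := by
  intro n hn h π i
  rw [hx n hn, hx n hn]
  simp only [Function.comp_apply]
  rw [Equiv.sum_comp π fun j => ((h j : ℕ) : ℝ)]

lemma IsProportional.stronglyBudgetBalanced {x : AllocRule} (hx : IsProportional x) :
    StronglyBudgetBalanced x := by
  intro n hn h
  rw [Finset.sum_congr rfl fun i _ => hx n hn h i, ← Finset.sum_div,
    div_self (sum_hash_pos hn h).ne']

lemma div_add_le_div_add {a b c : ℝ} (ha : 0 < a) (hab : a ≤ b) (hc : 0 ≤ c) :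
    a / (a + c) ≤ b / (b + c) := by
  rw [div_le_div_iff₀ (by linarith) (by linarith)]
  nlinarith

lemma IsProportional.sybilProof {x : AllocRule} (hx : IsProportional x) : SybilProof x := by
  rintro n m hn h i h' S ⟨hSne, e, he, hS, hle⟩
  rw [Finset.sum_congr rfl fun j _ => hx m hSne.choose.pos h' j, ← Finset.sum_div, hx n hn,
    sum_eq_sum_add_sum_embedding e S hS fun k => ((h' k : ℕ) : ℝ),
    sum_eq_sum_add_sum_embedding (Function.Embedding.subtype fun j => j ≠ i) {i} (by simp)
      fun k => ((h k : ℕ) : ℝ)]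
  simp only [he, Finset.sum_singleton, Function.Embedding.subtype_apply]
  exact div_add_le_div_add (Finset.sum_pos (fun k _ => Nat.cast_pos.2 (h' k).pos) hSne)
    (by exact_mod_cast hle) (by positivity)

lemma IsProportional.weaklyCollusionProof {x : AllocRule} (hx : IsProportional x) :
    WeaklyCollusionProof x := by
  rintro n m hn h T h' istar ⟨⟨i, hi⟩, e, he, hstar, hle⟩
  refine ⟨i, hi, ?_⟩
  have hA : 0 < ∑ j ∈ T, ((h j : ℕ) : ℝ) :=
    Finset.sum_pos (fun k _ => Nat.cast_pos.2 (h k).pos) ⟨i, hi⟩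
  rw [hx m istar.pos, hx n hn,
    sum_eq_sum_add_sum_embedding e {istar} (by simpa using hstar) fun k => ((h' k : ℕ) : ℝ),
    sum_eq_sum_add_sum_embedding (Function.Embedding.subtype fun j => j ∉ T) T (by simp)
      fun k => ((h k : ℕ) : ℝ)]
  simp only [he, Finset.sum_singleton, Function.Embedding.subtype_apply]
  have hle' : ((h' istar : ℕ) : ℝ) ≤ ∑ j ∈ T, ((h j : ℕ) : ℝ) := by exact_mod_cast hle
  have hshare := div_add_le_div_add (c := ∑ j : {j // j ∉ T}, ((h j.1 : ℕ) : ℝ))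
    (Nat.cast_pos.2 (h' istar).pos) hle' (by positivity)
  refine (mul_le_mul_of_nonneg_right hshare (share_mem_Icc h hi).1).trans_eq ?_
  rw [div_mul_div_comm, mul_comm (_ + _) _, mul_div_mul_left _ _ hA.ne']

/-- Corollary, possibility with deterministic rewards: for
every nonempty family `𝒰` of strictly increasing utility functions on `[0,1]`
vanishing at `0`, the proportional allocation rule is the unique (deterministic)
allocation rule that is symmetric, strongly budget-balanced, sybil-proof, and
weakly collusion-proof against `𝒰` under proportional sharing. -/
theorem deterministic_possibility (𝒰 : Set (ℝ → ℝ)) (hne : 𝒰.Nonempty)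
    (hmono : ∀ U ∈ 𝒰, StrictMonoOn U (Set.Icc (0 : ℝ) 1))
    (hzero : ∀ U ∈ 𝒰, U 0 = 0) (x : AllocRule) :
    (SymmetricRule x ∧ StronglyBudgetBalanced x ∧ SybilProof x ∧
      WeaklyCollusionProofAgainstFamilyDet 𝒰 x) ↔
    (∀ (n : ℕ), 0 < n → ∀ (h : Fin n → ℕ+) (i : Fin n),
      x.alloc h i = ((h i : ℕ) : ℝ) / ∑ j, ((h j : ℕ) : ℝ)) := by
  constructor
  · rintro ⟨hsym, hbal, hsyb, hcol⟩ n - h i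
    exact alloc_eq_proportional hsym hbal hsyb
      ((weaklyCollusionProofAgainstFamilyDet_iff hne hmono hbal).1 hcol) h i
  · intro H
    have hx : IsProportional x := H
    exact ⟨hx.symmetricRule, hx.stronglyBudgetBalanced, hx.sybilProof,
      (weaklyCollusionProofAgainstFamilyDet_iff hne hmono hx.stronglyBudgetBalanced).2
        hx.weaklyCollusionProof⟩
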